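/- (Flip rules) Let m,n ≥ 1, let σ ⊆ m^n be a partition, let t ∈ I_σ, and set t̄ := v⁻ − t (an outer corner of σ̄, so that σ̄∪t̄ is a partition). Then, as identities of rational functions in u over ℚ(α): (i) ∏_{b∈C^t_{σ∖t}} (u − uh_{σ∖t}(b)) / ∏_{b∈C^t_{σ}} (u − uh_{σ}(b)) = (1/(u−[(m,0)−t])) · ∏_{b∈R^{t̄}_{σ̄}} (u − uh_{σ̄∪t̄}(b)) / ∏_{b∈R^{t̄}_{σ̄}} (u − uh_{σ̄}(b)); and (ii) ∏_{b∈R^t_{σ∖t}} (u − lh_{σ∖t}(b)) / ∏_{b∈R^t_{σ}} (u − lh_{σ}(b)) = (1/(u−[t−(0,n)])) · ∏_{b∈C^{t̄}_{σ̄}} (u − lh_{σ̄∪t̄}(b)) / ∏_{b∈C^{t̄}_{σ̄}} (u − lh_{σ̄}(b)). -/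

import Mathlib

/-!
Common setup: boxes, Young diagrams as finite lower sets of boxes (French notation),
arms, legs, hooks, the field `ℚ(α)`, rational functions in `u` over `ℚ(α)`,
the functions `T_Γ`, corners, star products, rectangles and complements.
-/

open scoped BigOperators

attribute [local instance] Classical.propDecidable

namespace JackLR

/-- A box `(x, y)`: `x` is the column index, `y` the row index (French notation). -/
abbrev Box := ℕ × ℕ

/-- The field `ℚ(α)`. -/
abbrev K := RatFunc ℚ

/-- Rational functions in a variable `u` with coefficients in `ℚ(α)`. -/
abbrev F := RatFunc K

/-- The indeterminate `α`. -/
noncomputable def alpha : K := RatFunc.X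

/-- `[c] := α·x − y` for `c = (x, y) ∈ ℤ²`. -/
noncomputable def brk (c : ℤ × ℤ) : K := alpha * (c.1 : K) - (c.2 : K)

/-- The embedding of a box into `ℤ²`. -/
def zb (b : Box) : ℤ × ℤ := ((b.1 : ℤ), (b.2 : ℤ))

/-- `[b]` for a box `b`. -/
noncomputable def brkN (b : Box) : K := brk (zb b)

/-- `S` is the set of boxes of a Young diagram (equivalently, of a partition). -/
def IsYoung (S : Finset Box) : Prop := IsLowerSet (↑S : Set Box)

/-- The arm of `s`: number of boxes of `S` strictly to the right of `s` in its row. -/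
def arm (S : Finset Box) (s : Box) : ℕ := (S.filter fun b => b.2 = s.2 ∧ s.1 < b.1).card

/-- The leg of `s`: number of boxes of `S` strictly above `s` in its column. -/
def leg (S : Finset Box) (s : Box) : ℕ := (S.filter fun b => b.1 = s.1 ∧ s.2 < b.2).card

/-- Upper hook vector `h⁺_S(s) = (arm+1, −leg)`. -/
def hup (S : Finset Box) (s : Box) : ℤ × ℤ := ((arm S s : ℤ) + 1, -(leg S s : ℤ))

/-- Lower hook vector `h⁻_S(s) = (arm, −leg−1)`. -/
def hlo (S : Finset Box) (s : Box) : ℤ × ℤ := ((arm S s : ℤ), -((leg S s : ℤ) + 1))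

/-- Upper hook value `uh_S(s) = α(arm+1) + leg`. -/
noncomputable def uh (S : Finset Box) (s : Box) : K := brk (hup S s)

/-- Lower hook value `lh_S(s) = α·arm + leg + 1`. -/
noncomputable def lh (S : Finset Box) (s : Box) : K := brk (hlo S s)

/-- The variable `u`. -/
noncomputable def uu : F := RatFunc.X

/-- `T_□(w) = (w−[0,0])(w−[1,1]) / ((w−[1,0])(w−[0,1]))`. -/
noncomputable def Tbox (w : F) : F :=
  ((w - RatFunc.C (brk (0, 0))) * (w - RatFunc.C (brk (1, 1)))) /
    ((w - RatFunc.C (brk (1, 0))) * (w - RatFunc.C (brk (0, 1))))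

/-- `T_Γ` with the variable `u` replaced by `w`. -/
noncomputable def TMat (Γ : Multiset Box) (w : F) : F :=
  (Γ.map fun b => Tbox (w - RatFunc.C (brkN b))).prod

/-- `T_Γ(u) = ∏_{b ∈ Γ} T_□(u − [b])` for a finite multiset `Γ` of boxes. -/
noncomputable def TM (Γ : Multiset Box) : F := TMat Γ uu

/-- `T_S(u)` for a finite set `S` of boxes. -/
noncomputable def TS (S : Finset Box) : F := TM S.val

/-- The star product `μ * ν` as the multiset `{s + t : s ∈ μ, t ∈ ν}` with multiplicity. -/
def star (μ ν : Finset Box) : Multiset Box :=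
  μ.val.bind fun s => ν.val.map fun t => (s.1 + t.1, s.2 + t.2)

/-- The rectangular partition `m^n` (n rows of length m). -/
def rect (m n : ℕ) : Finset Box := Finset.range m ×ˢ Finset.range n

/-- `v⁻ = (m−1, n−1)`. -/
def vminus (m n : ℕ) : Box := (m - 1, n - 1)

/-- `b̄ := v⁻ − b`. -/
def conjBox (m n : ℕ) (b : Box) : Box := (m - 1 - b.1, n - 1 - b.2)

/-- The complement partition of `μ ⊆ m^n` inside `m^n`, with boxes `{v⁻ − b : b ∈ m^n, b ∉ μ}`. -/
def complIn (m n : ℕ) (μ : Finset Box) : Finset Box := (rect m n \ μ).image (conjBox m n)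

/-- `b̂ := (m−1−b₁, b₂)`. -/
def hflip (m : ℕ) (b : Box) : Box := (m - 1 - b.1, b.2)

/-- `b̌ := (b₁, n−1−b₂)`. -/
def vflip (n : ℕ) (b : Box) : Box := (b.1, n - 1 - b.2)

/-- Inner corners `I_S`: removable boxes. -/
def Inner (S : Finset Box) : Finset Box :=
  S.filter fun s => (s.1 + 1, s.2) ∉ S ∧ (s.1, s.2 + 1) ∉ S

/-- `t` can be added to `S` to give again a Young diagram. -/
def addable (S : Finset Box) (t : Box) : Prop :=
  t ∉ S ∧ (t.1 = 0 ∨ (t.1 - 1, t.2) ∈ S) ∧ (t.2 = 0 ∨ (t.1, t.2 - 1) ∈ S)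

/-- Outer corners `O_S`: addable boxes (these all satisfy the bounds used below). -/
noncomputable def Outer (S : Finset Box) : Finset Box :=
  ((Finset.range (S.sup Prod.fst + 2)) ×ˢ (Finset.range (S.sup Prod.snd + 2))).filter
    fun t => addable S t

/-- `I⁺_S = {s + (1,1) : s ∈ I_S}`. -/
noncomputable def Iplus (S : Finset Box) : Finset Box :=
  (Inner S).image fun s => (s.1 + 1, s.2 + 1)

/-- `R^s_S` : boxes of `S` in the same row as `s`. -/
def rowOf (S : Finset Box) (s : Box) : Finset Box := S.filter fun b => b.2 = s.2

/-- `C^s_S` : boxes of `S` in the same column as `s`. -/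
def colOf (S : Finset Box) (s : Box) : Finset Box := S.filter fun b => b.1 = s.1

/-- `a ∧ b := (min a₁ b₁, min a₂ b₂)`. -/
def meet (a b : Box) : Box := (min a.1 b.1, min a.2 b.2)

/-- Pole order of `f` at `u = c`: multiplicity of `(u − c)` in the denominator minus its
multiplicity in the numerator, `f` being written in lowest terms. -/
noncomputable def polOrder (f : F) (c : K) : ℤ :=
  (f.denom.rootMultiplicity c : ℤ) - (f.num.rootMultiplicity c : ℤ)

/-- `ϖ_S = ∏_{b ∈ S, b ≠ (0,0)} [b]`. -/
noncomputable def varpi (S : Finset Box) : K := ∏ b ∈ S.erase (0, 0), brkN b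

/-- Membership in a Young diagram in terms of its row lengths. -/
theorem IsYoung.exists_rowLen {S : Finset Box} (hS : IsYoung S) :
    ∃ r : ℕ → ℕ, Antitone r ∧ ∀ x y, (x, y) ∈ S ↔ x < r y := by
  have hex : ∀ y, ∃ x, (x, y) ∉ S := fun y => by
    by_contra! h
    exact Set.infinite_of_injective_forall_mem (f := fun x : ℕ => ((x, y) : Box))
      (fun _ _ e => congrArg Prod.fst e) h S.finite_toSet
  have key : ∀ x y, (x, y) ∈ S ↔ x < Nat.find (hex y) := fun x y => by
    constructor
    · intro hx
      by_contra! hle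
      exact Nat.find_spec (hex y) (hS (show ((_, y) : Box) ≤ (x, y) from ⟨hle, le_rfl⟩) hx)
    · intro hx
      by_contra hn
      exact Nat.find_min (hex y) hx hn
  refine ⟨fun y => Nat.find (hex y), fun y y' hy => ?_, key⟩
  by_contra! hlt
  have h1 := (key _ y').2 hlt
  have h2 := (key _ y).1 (hS (show ((_, y) : Box) ≤ (_, y') from ⟨le_rfl, hy⟩) h1)
  exact lt_irrefl _ h2

section Field

variable {L : Type*} [Field L]

/-- Hook products along the two sides of a lattice path from `(1, 0)` to `(M, N)`, whose
`j`-th vertical step has abscissa `a j`, telescope against each other. -/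
theorem prod_path_telescope (f : ℕ → ℕ → L) (hf : ∀ i j, f i j ≠ 0) (M N : ℕ) (a : ℕ → ℕ)
    (hmono : ∀ j k, j ≤ k → k < N → a j ≤ a k) (h1 : ∀ j < N, 1 ≤ a j) (hM : ∀ j < N, a j ≤ M)
    (hM1 : 1 ≤ M) :
    (1 / f 1 0) * ∏ j ∈ Finset.range N, (f (a j) j / f (a j) (j + 1)) =
      (1 / f M N) * ∏ i ∈ Finset.Ico 1 M,
        (f (i + 1) ((Finset.range N).filter fun j => a j ≤ i).card /
          f i ((Finset.range N).filter fun j => a j ≤ i).card) := by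
  have tele : ∀ k p, 1 ≤ p → p ≤ M →
      ∏ i ∈ Finset.Ico p M, (f (i + 1) k / f i k) = f M k / f p k := by
    intro k p _ hp
    clear hM hM1
    induction M, hp using Nat.le_induction with
    | base => simp [hf]
    | succ q hq ih =>
      rw [Finset.prod_Ico_succ_top hq, ih]
      have := hf q k
      have := hf p k
      field_simp
  induction N with
  | zero =>
    simp only [Finset.range_zero, Finset.prod_empty, Finset.filter_empty, Finset.card_empty]
    rw [tele 0 1 le_rfl hM1]
    have := hf M 0
    have := hf 1 0
    field_simp
  | succ N ih =>
    have ih := ih (fun j k hjk hk => hmono j k hjk (by omega)) (fun j hj => h1 j (by omega))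
      (fun j hj => hM j (by omega))
    have ha1 := h1 N (by omega)
    have haM := hM N (by omega)
    rw [Finset.prod_range_succ, ← mul_assoc, ih,
      ← Finset.prod_Ico_consecutive _ ha1 haM, ← Finset.prod_Ico_consecutive _ ha1 haM]
    have low : ∀ i ∈ Finset.Ico 1 (a N), ((Finset.range (N + 1)).filter fun j => a j ≤ i).card =
        ((Finset.range N).filter fun j => a j ≤ i).card := by
      intro i hi
      rw [Finset.mem_Ico] at hi
      rw [Finset.range_add_one, Finset.filter_insert, if_neg (by omega)]
    have high : ∀ i ∈ Finset.Ico (a N) M, ∀ k ≤ N + 1,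
        ((Finset.range k).filter fun j => a j ≤ i).card = k := by
      intro i hi k hk
      rw [Finset.mem_Ico] at hi
      rw [Finset.filter_true_of_mem, Finset.card_range]
      intro j hj
      rw [Finset.mem_range] at hj
      exact (hmono j N (by omega) (by omega)).trans hi.1
    have e1 : ∏ i ∈ Finset.Ico (a N) M,
        (f (i + 1) ((Finset.range N).filter fun j => a j ≤ i).card /
          f i ((Finset.range N).filter fun j => a j ≤ i).card) = f M N / f (a N) N := by
      rw [← tele N _ ha1 haM]
      exact Finset.prod_congr rfl fun i hi => by rw [high i hi N (by omega)]
    have e2 : ∏ i ∈ Finset.Ico (a N) M,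
        (f (i + 1) ((Finset.range (N + 1)).filter fun j => a j ≤ i).card /
          f i ((Finset.range (N + 1)).filter fun j => a j ≤ i).card) =
          f M (N + 1) / f (a N) (N + 1) := by
      rw [← tele (N + 1) _ ha1 haM]
      exact Finset.prod_congr rfl fun i hi => by rw [high i hi (N + 1) le_rfl]
    have e3 : ∏ i ∈ Finset.Ico 1 (a N),
        (f (i + 1) ((Finset.range (N + 1)).filter fun j => a j ≤ i).card /
          f i ((Finset.range (N + 1)).filter fun j => a j ≤ i).card) =
        ∏ i ∈ Finset.Ico 1 (a N),
        (f (i + 1) ((Finset.range N).filter fun j => a j ≤ i).card /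
          f i ((Finset.range N).filter fun j => a j ≤ i).card) :=
      Finset.prod_congr rfl fun i hi => by rw [low i hi]
    rw [e1, e2, e3]
    have := hf M N
    have := hf M (N + 1)
    have := hf (a N) N
    have := hf (a N) (N + 1)
    field_simp

theorem mem_complIn {m n : ℕ} {σ : Finset Box} {x y : ℕ} :
    (x, y) ∈ complIn m n σ ↔ x < m ∧ y < n ∧ (m - 1 - x, n - 1 - y) ∉ σ := by
  simp only [complIn, rect, conjBox, Finset.mem_image, Finset.mem_sdiff, Finset.mem_product,
    Finset.mem_range, Prod.exists, Prod.mk.injEq]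
  constructor
  · rintro ⟨p, q, ⟨⟨hp, hq⟩, hn⟩, rfl, rfl⟩
    refine ⟨by omega, by omega, ?_⟩
    rwa [show m - 1 - (m - 1 - p) = p by omega, show n - 1 - (n - 1 - q) = q by omega]
  · rintro ⟨hx, hy, hn⟩
    exact ⟨_, _, ⟨⟨by omega, by omega⟩, hn⟩, by omega, by omega⟩

/-- The column-to-row flip rule for hook weights `f (arm + 1) leg`. -/
theorem flip_hook (f : ℕ → ℕ → L) (hf : ∀ i j, f i j ≠ 0) (m n : ℕ) (σ : Finset Box)
    (hσ : IsYoung σ) (hsub : σ ⊆ rect m n) (t : Box) (ht : t ∈ Inner σ) :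
    (∏ b ∈ colOf (σ.erase t) t, f (arm (σ.erase t) b + 1) (leg (σ.erase t) b)) /
        ∏ b ∈ colOf σ t, f (arm σ b + 1) (leg σ b) =
      (1 / f (m - t.1) t.2) *
        ((∏ b ∈ rowOf (complIn m n σ) (conjBox m n t),
            f (arm (insert (conjBox m n t) (complIn m n σ)) b + 1)
              (leg (insert (conjBox m n t) (complIn m n σ)) b)) /
          ∏ b ∈ rowOf (complIn m n σ) (conjBox m n t),
            f (arm (complIn m n σ) b + 1) (leg (complIn m n σ) b)) := by
  obtain ⟨t₁, t₂⟩ := t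
  obtain ⟨r, hr, hmem⟩ := hσ.exists_rowLen
  simp only [Inner, Finset.mem_filter, hmem] at ht
  obtain ⟨h1, h2, h3⟩ := ht
  have hrt : r t₂ = t₁ + 1 := by omega
  have hbd : ∀ x y, x < r y → x < m ∧ y < n := fun x y h => by
    simpa [rect] using hsub ((hmem x y).2 h)
  have hrm : ∀ y, r y ≤ m := fun y => by
    by_contra! h
    exact lt_irrefl _ (hbd m y h).1
  obtain ⟨htm, htn⟩ := hbd _ _ h1
  have hle : ∀ y ≤ t₂, t₁ < r y := fun y hy => by have := hr hy; omega
  have hgt : ∀ y, t₂ < y → r y ≤ t₁ := fun y hy => by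
    have := hr (show t₂ + 1 ≤ y from hy); omega
  have hinj₁ : ∀ y, Function.Injective fun x : ℕ => ((x, y) : Box) :=
    fun y _ _ e => congrArg Prod.fst e
  have hinj₂ : ∀ x, Function.Injective fun y : ℕ => ((x, y) : Box) :=
    fun x _ _ e => congrArg Prod.snd e
  have hcol : colOf σ (t₁, t₂) = (Finset.range (t₂ + 1)).image fun y => (t₁, y) := by
    ext ⟨x, y⟩
    simp only [colOf, Finset.mem_filter, hmem, Finset.mem_image, Finset.mem_range, Prod.mk.injEq]
    constructor
    · rintro ⟨h, rfl⟩
      refine ⟨y, ?_, rfl, rfl⟩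
      by_contra! hy
      have := hgt y hy
      omega
    · rintro ⟨y, hy, rfl, rfl⟩
      exact ⟨hle _ (by omega), rfl⟩
  have hcol' : colOf (σ.erase (t₁, t₂)) (t₁, t₂) =
      (Finset.range t₂).image fun y => (t₁, y) := by
    have : colOf (σ.erase (t₁, t₂)) (t₁, t₂) = (colOf σ (t₁, t₂)).erase (t₁, t₂) := by
      simp only [colOf, Finset.filter_erase]
    rw [this, hcol]
    ext ⟨x, y⟩
    simp only [Finset.mem_erase, Finset.mem_image, Finset.mem_range, Prod.mk.injEq, ne_eq]
    constructor
    · rintro ⟨hne, y, hy, rfl, rfl⟩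
      exact ⟨y, by omega, rfl, rfl⟩
    · rintro ⟨y, hy, rfl, rfl⟩
      exact ⟨by omega, y, by omega, rfl, rfl⟩
  have harm : ∀ y, arm σ (t₁, y) = r y - t₁ - 1 := fun y => by
    have : (σ.filter fun b => b.2 = y ∧ t₁ < b.1) =
        (Finset.Ioo t₁ (r y)).image fun x => (x, y) := by
      ext ⟨p, q⟩
      simp only [Finset.mem_filter, hmem, Finset.mem_image, Finset.mem_Ioo, Prod.mk.injEq]
      constructor
      · rintro ⟨hp, rfl, hlt⟩
        exact ⟨p, by omega, rfl, rfl⟩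
      · rintro ⟨p, hp, rfl, rfl⟩
        exact ⟨hp.2, rfl, hp.1⟩
    rw [arm, this, Finset.card_image_of_injective _ (hinj₁ y), Nat.card_Ioo]
  have hleg : ∀ y ≤ t₂, leg σ (t₁, y) = t₂ - y := fun y hy => by
    have : (σ.filter fun b => b.1 = t₁ ∧ y < b.2) =
        (Finset.Ioc y t₂).image fun y => (t₁, y) := by
      ext ⟨p, q⟩
      simp only [Finset.mem_filter, hmem, Finset.mem_image, Finset.mem_Ioc, Prod.mk.injEq]
      constructor
      · rintro ⟨hp, rfl, hlt⟩
        refine ⟨q, ⟨hlt, ?_⟩, rfl, rfl⟩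
        by_contra! hq
        have := hgt q hq
        omega
      · rintro ⟨q, hq, rfl, rfl⟩
        exact ⟨hle q hq.2, rfl, hq.1⟩
    rw [leg, this, Finset.card_image_of_injective _ (hinj₂ t₁), Nat.card_Ioc]
  have harm' : ∀ y < t₂, arm (σ.erase (t₁, t₂)) (t₁, y) = r y - t₁ - 1 := fun y hy => by
    rw [← harm, arm, arm, Finset.filter_erase, Finset.erase_eq_of_notMem]
    simp only [Finset.mem_filter]
    omega
  have hleg' : ∀ y < t₂, leg (σ.erase (t₁, t₂)) (t₁, y) = t₂ - 1 - y := fun y hy => by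
    have h := hleg y hy.le
    rw [leg] at h ⊢
    rw [Finset.filter_erase, Finset.card_erase_of_mem, h]
    · omega
    · simp only [Finset.mem_filter, hmem]
      exact ⟨h1, trivial, hy⟩
  have hrow : rowOf (complIn m n σ) (conjBox m n (t₁, t₂)) =
      (Finset.Ico 1 (m - t₁)).image fun i => (m - 1 - t₁ - i, n - 1 - t₂) := by
    ext ⟨x, y⟩
    rw [rowOf, Finset.mem_filter]
    simp only [conjBox, mem_complIn, hmem, Finset.mem_image, Finset.mem_Ico, Prod.mk.injEq]
    constructor
    · rintro ⟨⟨hx, hy, h⟩, rfl⟩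
      rw [show n - 1 - (n - 1 - t₂) = t₂ by omega] at h
      exact ⟨m - 1 - x - t₁, by omega, by omega, rfl⟩
    · rintro ⟨i, hi, rfl, rfl⟩
      rw [show n - 1 - (n - 1 - t₂) = t₂ by omega]
      omega
  have hcarm : ∀ i ∈ Finset.Ico 1 (m - t₁),
      arm (complIn m n σ) (m - 1 - t₁ - i, n - 1 - t₂) = i - 1 := fun i hi => by
    rw [Finset.mem_Ico] at hi
    have : ((complIn m n σ).filter fun b => b.2 = n - 1 - t₂ ∧ m - 1 - t₁ - i < b.1) =
        (Finset.Ioo (m - 1 - t₁ - i) (m - 1 - t₁)).image fun x => (x, n - 1 - t₂) := by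
      ext ⟨p, q⟩
      simp only [Finset.mem_filter, mem_complIn, hmem, Finset.mem_image, Finset.mem_Ioo,
        Prod.mk.injEq]
      have e : n - 1 - (n - 1 - t₂) = t₂ := by omega
      constructor
      · rintro ⟨⟨hp, hq, h⟩, rfl, hlt⟩
        rw [e] at h
        exact ⟨p, by omega, rfl, rfl⟩
      · rintro ⟨p, hp, rfl, rfl⟩
        rw [e]
        omega
    rw [arm, this, Finset.card_image_of_injective _ (hinj₁ _), Nat.card_Ioo]
    omega
  have htbar : (m - 1 - t₁, n - 1 - t₂) ∉ complIn m n σ := by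
    rw [mem_complIn, hmem, show n - 1 - (n - 1 - t₂) = t₂ by omega]
    omega
  have hcarm' : ∀ i ∈ Finset.Ico 1 (m - t₁),
      arm (insert (conjBox m n (t₁, t₂)) (complIn m n σ)) (m - 1 - t₁ - i, n - 1 - t₂) = i :=
    fun i hi => by
    have h := hcarm i hi
    rw [Finset.mem_Ico] at hi
    rw [arm] at h ⊢
    rw [conjBox, Finset.filter_insert, if_pos (by dsimp only; omega),
      Finset.card_insert_of_notMem (fun h' => htbar (Finset.mem_filter.1 h').1), h]
    omega
  have hcleg' : ∀ i ∈ Finset.Ico 1 (m - t₁),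
      leg (insert (conjBox m n (t₁, t₂)) (complIn m n σ)) (m - 1 - t₁ - i, n - 1 - t₂) =
        leg (complIn m n σ) (m - 1 - t₁ - i, n - 1 - t₂) := fun i hi => by
    rw [Finset.mem_Ico] at hi
    rw [leg, leg, conjBox, Finset.filter_insert, if_neg (by dsimp only; omega)]
  have hcleg : ∀ i ∈ Finset.Ico 1 (m - t₁),
      leg (complIn m n σ) (m - 1 - t₁ - i, n - 1 - t₂) =
        ((Finset.range t₂).filter fun j => r (t₂ - 1 - j) - t₁ ≤ i).card := fun i hi => by
    rw [Finset.mem_Ico] at hi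
    have : ((complIn m n σ).filter fun b => b.1 = m - 1 - t₁ - i ∧ n - 1 - t₂ < b.2) =
        ((Finset.range t₂).filter fun j => r (t₂ - 1 - j) - t₁ ≤ i).image
          fun j => (m - 1 - t₁ - i, n - t₂ + j) := by
      ext ⟨p, q⟩
      simp only [Finset.mem_filter, mem_complIn, hmem, Finset.mem_image, Finset.mem_range,
        Prod.mk.injEq]
      constructor
      · rintro ⟨⟨hp, hq, h⟩, rfl, hlt⟩
        refine ⟨q - (n - t₂), ⟨by omega, ?_⟩, rfl, by omega⟩
        rw [show t₂ - 1 - (q - (n - t₂)) = n - 1 - q by omega]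
        omega
      · rintro ⟨j, ⟨hj, h⟩, rfl, rfl⟩
        rw [show n - 1 - (n - t₂ + j) = t₂ - 1 - j by omega]
        omega
    rw [leg, this, Finset.card_image_of_injective]
    intro j k h
    simpa using h
  have hinjrow : Set.InjOn (fun i => ((m - 1 - t₁ - i, n - 1 - t₂) : Box))
      (Finset.Ico 1 (m - t₁)) := by
    intro i hi j hj h
    simp only [Finset.coe_Ico, Set.mem_Ico, Prod.mk.injEq] at hi hj h
    omega
  rw [hcol, hcol', hrow, Finset.prod_image (hinj₂ t₁).injOn, Finset.prod_image (hinj₂ t₁).injOn,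
    Finset.prod_image hinjrow, Finset.prod_image hinjrow, ← Finset.prod_div_distrib]
  have key := prod_path_telescope f hf (m - t₁) t₂ (fun j => r (t₂ - 1 - j) - t₁)
    (fun j k hjk hk => Nat.sub_le_sub_right (hr (by omega)) _)
    (fun j hj => by have := hle (t₂ - 1 - j) (by omega); omega)
    (fun j hj => Nat.sub_le_sub_right (hrm _) _) (by omega)
  convert key using 1
  · rw [Finset.prod_range_succ, harm, hleg t₂ le_rfl, hrt,
      Finset.prod_div_distrib, ← Finset.prod_range_reflect _ t₂]
    nth_rw 2 [← Finset.prod_range_reflect _ t₂]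
    rw [show t₁ + 1 - t₁ - 1 + 1 = 1 by omega, Nat.sub_self, div_mul_div_comm, one_mul,
      mul_comm (f 1 0)]
    congr 1
    · refine Finset.prod_congr rfl fun j hj => ?_
      rw [Finset.mem_range] at hj
      have := hle (t₂ - 1 - j) (by omega)
      rw [harm' _ (by omega), hleg' _ (by omega)]
      congr 1 <;> omega
    · congr 1
      refine Finset.prod_congr rfl fun j hj => ?_
      rw [Finset.mem_range] at hj
      have := hle (t₂ - 1 - j) (by omega)
      rw [harm, hleg _ (by omega)]
      congr 1 <;> omega
  · congr 1
    refine Finset.prod_congr rfl fun i hi => ?_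
    rw [hcarm' i hi, hcleg' i hi, hcarm i hi, hcleg i hi]
    rw [Finset.mem_Ico] at hi
    rw [Nat.sub_add_cancel hi.1]

end Field

/-- The transpose of a finite set of boxes. -/
def transpose (S : Finset Box) : Finset Box := S.map (Equiv.prodComm ℕ ℕ).toEmbedding

theorem mem_transpose {S : Finset Box} {b : Box} : b ∈ transpose S ↔ b.swap ∈ S := by
  simp [transpose, Finset.mem_map_equiv]

theorem card_filter_transpose (S : Finset Box) (p : Box → Prop) [DecidablePred p] :
    ((transpose S).filter p).card = (S.filter fun b => p b.swap).card := by
  rw [transpose, Finset.filter_map, Finset.card_map]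
  rfl

theorem arm_transpose (S : Finset Box) (b : Box) : arm (transpose S) b.swap = leg S b :=
  card_filter_transpose S fun c => c.2 = b.1 ∧ b.2 < c.1

theorem leg_transpose (S : Finset Box) (b : Box) : leg (transpose S) b.swap = arm S b :=
  card_filter_transpose S fun c => c.1 = b.2 ∧ b.1 < c.2

theorem colOf_transpose (S : Finset Box) (b : Box) :
    colOf (transpose S) b.swap = transpose (rowOf S b) := by
  ext c
  simp [colOf, rowOf, mem_transpose]

theorem rowOf_transpose (S : Finset Box) (b : Box) :
    rowOf (transpose S) b.swap = transpose (colOf S b) := by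
  ext c
  simp [colOf, rowOf, mem_transpose]

theorem erase_transpose (S : Finset Box) (b : Box) :
    (transpose S).erase b.swap = transpose (S.erase b) := by
  ext c
  simp [mem_transpose, Prod.swap_eq_iff_eq_swap]

theorem insert_transpose (S : Finset Box) (b : Box) :
    insert b.swap (transpose S) = transpose (insert b S) := by
  ext c
  simp [mem_transpose, Prod.swap_eq_iff_eq_swap]

theorem complIn_transpose (m n : ℕ) (S : Finset Box) :
    complIn n m (transpose S) = transpose (complIn m n S) := by
  ext ⟨x, y⟩
  simp only [mem_transpose, Prod.swap_prod_mk, mem_complIn]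
  tauto

theorem prod_transpose {L : Type*} [CommMonoid L] (S : Finset Box) (g : Box → L) :
    ∏ b ∈ transpose S, g b = ∏ b ∈ S, g b.swap :=
  Finset.prod_map _ _ _

theorem IsYoung.transpose {S : Finset Box} (hS : IsYoung S) : IsYoung (transpose S) := by
  intro a b hba ha
  rw [Finset.mem_coe, mem_transpose] at ha ⊢
  exact hS (show b.swap ≤ a.swap from ⟨hba.2, hba.1⟩) ha

/-- The row-to-column flip rule for hook weights `f arm (leg + 1)`. -/
theorem flip_hook_transpose {L : Type*} [Field L] (f : ℕ → ℕ → L) (hf : ∀ i j, f i j ≠ 0)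
    (m n : ℕ) (σ : Finset Box) (hσ : IsYoung σ) (hsub : σ ⊆ rect m n) (t : Box)
    (ht : t ∈ Inner σ) :
    (∏ b ∈ rowOf (σ.erase t) t, f (arm (σ.erase t) b) (leg (σ.erase t) b + 1)) /
        ∏ b ∈ rowOf σ t, f (arm σ b) (leg σ b + 1) =
      (1 / f t.1 (n - t.2)) *
        ((∏ b ∈ colOf (complIn m n σ) (conjBox m n t),
            f (arm (insert (conjBox m n t) (complIn m n σ)) b)
              (leg (insert (conjBox m n t) (complIn m n σ)) b + 1)) /
          ∏ b ∈ colOf (complIn m n σ) (conjBox m n t),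
            f (arm (complIn m n σ) b) (leg (complIn m n σ) b + 1)) := by
  have hsub' : transpose σ ⊆ rect n m := fun b hb => by
    have := hsub (mem_transpose.1 hb)
    simp only [rect, Finset.mem_product, Finset.mem_range, Prod.fst_swap, Prod.snd_swap] at this ⊢
    exact this.symm
  have ht' : t.swap ∈ Inner (transpose σ) := by
    simp only [Inner, Finset.mem_filter, mem_transpose, Prod.swap_swap, Prod.fst_swap,
      Prod.snd_swap, Prod.swap_prod_mk] at ht ⊢
    exact ⟨ht.1, ht.2.2, ht.2.1⟩
  have h := flip_hook (fun i j => f j i) (fun i j => hf j i) n m (transpose σ) hσ.transpose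
    hsub' t.swap ht'
  have hconj : conjBox n m t.swap = (conjBox m n t).swap := rfl
  simpa only [hconj, erase_transpose, complIn_transpose, insert_transpose, colOf_transpose,
    rowOf_transpose, prod_transpose, arm_transpose, leg_transpose, Prod.fst_swap,
    Prod.snd_swap] using h

theorem uu_sub_C_ne_zero (c : K) : uu - RatFunc.C c ≠ 0 := by
  rw [uu, ← RatFunc.algebraMap_X, ← RatFunc.algebraMap_C, ← map_sub]
  exact RatFunc.algebraMap_ne_zero (Polynomial.X_sub_C_ne_zero c)

/-- **Flip rules.** Column/row products at an inner corner `t` of `σ ⊆ m^n`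
flip to row/column products at the outer corner `t̄ = v⁻ − t` of `σ̄`. -/
theorem stmt5 (m n : ℕ) (hm : 1 ≤ m) (hn : 1 ≤ n) (σ : Finset Box) (hσ : IsYoung σ)
    (hsub : σ ⊆ rect m n) (t : Box) (ht : t ∈ Inner σ) :
    (((∏ b ∈ colOf (σ.erase t) t, (uu - RatFunc.C (uh (σ.erase t) b))) /
        ∏ b ∈ colOf σ t, (uu - RatFunc.C (uh σ b))) =
      (1 / (uu - RatFunc.C (brk (((m : ℤ), (0 : ℤ)) - zb t)))) *
        ((∏ b ∈ rowOf (complIn m n σ) (conjBox m n t),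
            (uu - RatFunc.C (uh (insert (conjBox m n t) (complIn m n σ)) b))) /
          ∏ b ∈ rowOf (complIn m n σ) (conjBox m n t),
            (uu - RatFunc.C (uh (complIn m n σ) b)))) ∧
    (((∏ b ∈ rowOf (σ.erase t) t, (uu - RatFunc.C (lh (σ.erase t) b))) /
        ∏ b ∈ rowOf σ t, (uu - RatFunc.C (lh σ b))) =
      (1 / (uu - RatFunc.C (brk (zb t - ((0 : ℤ), (n : ℤ)))))) *
        ((∏ b ∈ colOf (complIn m n σ) (conjBox m n t),
            (uu - RatFunc.C (lh (insert (conjBox m n t) (complIn m n σ)) b))) /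
          ∏ b ∈ colOf (complIn m n σ) (conjBox m n t),
            (uu - RatFunc.C (lh (complIn m n σ) b)))) := by
  have hb := hsub (Finset.mem_filter.1 ht).1
  simp only [rect, Finset.mem_product, Finset.mem_range] at hb
  have hf : ∀ i j : ℕ, uu - RatFunc.C (brk ((i : ℤ), -(j : ℤ))) ≠ 0 :=
    fun i j => uu_sub_C_ne_zero _
  have h1 : ((m : ℤ), (0 : ℤ)) - zb t = (((m - t.1 : ℕ) : ℤ), -((t.2 : ℕ) : ℤ)) := by
    rw [Nat.cast_sub hb.1.le]
    simp [zb]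
  have h2 : zb t - ((0 : ℤ), (n : ℤ)) = (((t.1 : ℕ) : ℤ), -((n - t.2 : ℕ) : ℤ)) := by
    rw [Nat.cast_sub hb.2.le]
    simp [zb]
  rw [h1, h2]
  constructor
  · simpa only [uh, hup, Nat.cast_add, Nat.cast_one] using flip_hook _ hf m n σ hσ hsub t ht
  · simpa only [lh, hlo, Nat.cast_add, Nat.cast_one] using
      flip_hook_transpose _ hf m n σ hσ hsub t ht

end JackLR
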